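/- Level g−1 intersection numbers: let g ≥ 2, set n = 2g+2, and let 1 ≤ i ≤ g. Then I_{g−1}(n−i−2, i, 1, 1) = g−1 if i = g−1, and I_{g−1}(n−i−2, i, 1, 1) = 0 if i ≠ g−1. -/

import Mathlib

open Finset

/-- Three-point fusion rank for sl₂ at level ℓ. -/
def N₃ (ℓ a b c : ℕ) : ℕ :=
  if (a + b + c) % 2 = 0 ∧ a + b + c ≤ 2 * ℓ ∧ a ≤ (a + b + c) / 2 ∧
      b ≤ (a + b + c) / 2 ∧ c ≤ (a + b + c) / 2 then 1 else 0

/-- Auxiliary rank function on the reversed list of weights: the recursion removes the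
first two entries (the last two weights) and inserts μ. -/
def Nrev (ℓ : ℕ) : List ℕ → ℕ
  | [] => 1
  | [a] => if a = 0 then 1 else 0
  | [a, b] => if a = b then 1 else 0
  | [a, b, c] => N₃ ℓ c b a
  | a :: b :: c :: d :: rest =>
      ∑ μ ∈ Finset.range (ℓ + 1), Nrev ℓ (μ :: c :: d :: rest) * N₃ ℓ b a μ
  termination_by l => l.length

/-- The sl₂ rank N(λ₁,…,λₙ) of the conformal blocks bundle V(sl₂,ℓ,λ⃗). -/
def N (ℓ : ℕ) (l : List ℕ) : ℕ := Nrev ℓ l.reverse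

/-- Casimir scalar c(α) = α²/2 + α. -/
def cas (α : ℕ) : ℚ := (α : ℚ) ^ 2 / 2 + α

/-- Fakhruddin's degree of V(sl₂,ℓ,(μ₁,μ₂,μ₃,μ₄)) on M̄₀,₄. -/
def degF (ℓ μ₁ μ₂ μ₃ μ₄ : ℕ) : ℚ :=
  (1 / (2 * ((ℓ : ℚ) + 2))) *
    ((N ℓ [μ₁, μ₂, μ₃, μ₄] : ℚ) * (cas μ₁ + cas μ₂ + cas μ₃ + cas μ₄)
      - ∑ α ∈ Finset.range (ℓ + 1), cas α *
          ((N₃ ℓ μ₁ μ₂ α * N₃ ℓ μ₃ μ₄ α + N₃ ℓ μ₁ μ₃ α * N₃ ℓ μ₂ μ₄ α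
            + N₃ ℓ μ₁ μ₄ α * N₃ ℓ μ₂ μ₃ α : ℕ) : ℚ))

/-- r_ℓ(j,t): determined by r_ℓ(j,t)=0 for t<0 or t>ℓ, r_ℓ(0,0)=1, r_ℓ(0,t)=0 otherwise,
and r_ℓ(j,t) = r_ℓ(j−1,t−1) + r_ℓ(j−1,t+1) for j ≥ 1, 0 ≤ t ≤ ℓ. -/
def rL (ℓ : ℕ) : ℕ → ℤ → ℕ
  | 0, t => if t = 0 then 1 else 0
  | j + 1, t =>
      if t < 0 ∨ (ℓ : ℤ) < t then 0 else rL ℓ j (t - 1) + rL ℓ j (t + 1)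

/-- r_∞(j,t): determined by r_∞(j,t)=0 for t<0 or t>j, r_∞(0,0)=1,
and r_∞(j,t) = r_∞(j−1,t−1) + r_∞(j−1,t+1) for j ≥ 1, 0 ≤ t ≤ j. -/
def rInf : ℕ → ℤ → ℕ
  | 0, t => if t = 0 then 1 else 0
  | j + 1, t =>
      if t < 0 ∨ ((j : ℤ) + 1) < t then 0 else rInf j (t - 1) + rInf j (t + 1)

/-- Fakhruddin's intersection number of D^{sl₂}_{ℓ,(1,…,1)} with the F-curve
F_{j₁,j₂,j₃,j₄}. -/
def IF (ℓ j₁ j₂ j₃ j₄ : ℕ) : ℚ :=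
  ∑ μ₁ ∈ Finset.range (ℓ + 1), ∑ μ₂ ∈ Finset.range (ℓ + 1),
    ∑ μ₃ ∈ Finset.range (ℓ + 1), ∑ μ₄ ∈ Finset.range (ℓ + 1),
      degF ℓ μ₁ μ₂ μ₃ μ₄ * (rL ℓ j₁ (μ₁ : ℤ) : ℚ) * (rL ℓ j₂ (μ₂ : ℤ) : ℚ)
        * (rL ℓ j₃ (μ₃ : ℤ) : ℚ) * (rL ℓ j₄ (μ₄ : ℤ) : ℚ)

/-- Binomial coefficient C(n,m) with integer lower argument, with the convention
C(n,m) = 0 for m < 0. -/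
def chooseZ (n : ℕ) (m : ℤ) : ℕ := if m < 0 then 0 else n.choose m.toNat

theorem N₃_one_one (ℓ α : ℕ) (hℓ : 1 ≤ ℓ) :
    N₃ ℓ 1 1 α = (if α = 0 then 1 else 0) + (if α = 2 then (if 2 ≤ ℓ then 1 else 0) else 0) := by
  unfold N₃
  split_ifs <;> omega

theorem N₃_one_right (ℓ a α : ℕ) (ha : a ≤ ℓ) (hα : α ≤ ℓ) :
    N₃ ℓ a 1 α =
      (if α = a + 1 then 1 else 0) + (if α = a - 1 then (if 1 ≤ a then 1 else 0) else 0) := by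
  unfold N₃
  split_ifs <;> omega

theorem sum_mul_N₃_one_one (ℓ : ℕ) (hℓ : 1 ≤ ℓ) (f : ℕ → ℚ) :
    ∑ α ∈ Finset.range (ℓ + 1), f α * (N₃ ℓ 1 1 α : ℚ) = f 0 + if 2 ≤ ℓ then f 2 else 0 := by
  simp_rw [N₃_one_one ℓ _ hℓ]
  push_cast
  simp_rw [mul_add, mul_ite, mul_one, mul_zero]
  rw [Finset.sum_add_distrib, Finset.sum_ite_eq', Finset.sum_ite_eq']
  split_ifs <;> simp_all

theorem sum_mul_N₃_one_right (ℓ a : ℕ) (ha : a ≤ ℓ) (f : ℕ → ℚ) :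
    ∑ α ∈ Finset.range (ℓ + 1), f α * (N₃ ℓ a 1 α : ℚ) =
      (if a + 1 ≤ ℓ then f (a + 1) else 0) + if 1 ≤ a then f (a - 1) else 0 := by
  have h : ∀ α ∈ Finset.range (ℓ + 1), f α * (N₃ ℓ a 1 α : ℚ) =
      (if α = a + 1 then f α else 0) +
        (if α = a - 1 then (if 1 ≤ a then f α else 0) else 0) := by
    intro α hα
    rw [N₃_one_right ℓ a α ha (by simpa [Nat.lt_succ_iff] using hα)]
    push_cast
    simp only [mul_add, mul_ite, mul_one, mul_zero]
  rw [Finset.sum_congr rfl h, Finset.sum_add_distrib, Finset.sum_ite_eq', Finset.sum_ite_eq']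
  have : a - 1 < ℓ + 1 := by omega
  simp [this]

theorem N_pair_one_one (ℓ a b : ℕ) :
    (N ℓ [a, b, 1, 1] : ℚ) = ∑ α ∈ Finset.range (ℓ + 1), (N₃ ℓ a b α : ℚ) * (N₃ ℓ 1 1 α : ℚ) := by
  simp [N, Nrev]

/-- The degree of `V(a, b, 1, 1)` vanishes except at the top weights `a = b = ℓ`. -/
theorem degF_one_one (ℓ a b : ℕ) (hℓ : 1 ≤ ℓ) (ha : a ≤ ℓ) (hb : b ≤ ℓ) :
    degF ℓ a b 1 1 = if a = ℓ then (if b = ℓ then 1 else 0) else 0 := by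
  have hsum : ∑ α ∈ Finset.range (ℓ + 1), cas α *
        ((N₃ ℓ a b α * N₃ ℓ 1 1 α + N₃ ℓ a 1 α * N₃ ℓ b 1 α
          + N₃ ℓ a 1 α * N₃ ℓ b 1 α : ℕ) : ℚ) =
      ∑ α ∈ Finset.range (ℓ + 1), (cas α * (N₃ ℓ a b α : ℚ)) * (N₃ ℓ 1 1 α : ℚ) +
      ∑ α ∈ Finset.range (ℓ + 1), (2 * cas α * (N₃ ℓ b 1 α : ℚ)) * (N₃ ℓ a 1 α : ℚ) := by
    rw [← Finset.sum_add_distrib]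
    refine Finset.sum_congr rfl fun α _ => ?_
    push_cast
    ring
  have hpos : (ℓ : ℚ) + 2 ≠ 0 := by positivity
  unfold degF
  rw [hsum, N_pair_one_one, sum_mul_N₃_one_one ℓ hℓ, sum_mul_N₃_one_one ℓ hℓ,
    sum_mul_N₃_one_right ℓ a ha]
  have h0 : N₃ ℓ a b 0 = if a = b then 1 else 0 := by
    unfold N₃; split_ifs <;> omega
  have h2 : N₃ ℓ a b 2 = if (a = b ∧ 1 ≤ a ∧ a + 1 ≤ ℓ) ∨ b = a + 2 ∨ a = b + 2 then 1 else 0 := by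
    unfold N₃; split_ifs <;> omega
  have hup : a + 1 ≤ ℓ → N₃ ℓ b 1 (a + 1) = if b = a ∨ b = a + 2 then 1 else 0 := by
    intro h; unfold N₃; split_ifs <;> omega
  have hdown : 1 ≤ a → N₃ ℓ b 1 (a - 1) = if b = a ∨ a = b + 2 then 1 else 0 := by
    intro h; unfold N₃; split_ifs <;> omega
  rw [h0, h2]
  rcases Nat.eq_zero_or_pos a with rfl | hapos
  · rw [hup (by omega)]
    rcases eq_or_ne b 0 with rfl | hb0
    · have : (0 : ℕ) ≠ ℓ := by omega
      have h' : 1 ≤ ℓ := hℓ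
      simp [cas, this, h']
      norm_num
    · rcases eq_or_ne b 2 with rfl | hb2
      · have : (0 : ℕ) ≠ ℓ := by omega
        simp [cas, this, hb, hℓ]
        norm_num
      · have : (0 : ℕ) ≠ ℓ := by omega
        simp [cas, this, hb0, hb0.symm, hb2]
  · obtain ⟨k, rfl⟩ : ∃ k, a = k + 1 := ⟨a - 1, by omega⟩
    rw [hdown (by omega)]
    rcases eq_or_ne b (k + 1) with rfl | hne
    · rcases eq_or_lt_of_le ha with rfl | hlt
      · simp [cas] at hpos ⊢
        field_simp
        ring
      · rw [hup (by omega)]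
        have h1 : k + 1 + 1 ≤ ℓ := hlt
        have h2 : 2 ≤ ℓ := by omega
        have h3 : k + 1 ≠ ℓ := by omega
        simp [cas, h1, h2, h3]
        right
        ring
    · rcases eq_or_ne b (k + 3) with rfl | hne'
      · rw [hup (by omega)]
        have h1 : k + 1 + 1 ≤ ℓ := by omega
        have h2 : 2 ≤ ℓ := by omega
        have h3 : k + 1 ≠ ℓ := by omega
        simp [cas, h1, h2, h3]
        right
        ring
      · rcases eq_or_ne k (b + 1) with rfl | hne2
        · have h2 : 2 ≤ ℓ := by omega
          have h3 : b ≠ ℓ := by omega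
          have h4 : N₃ ℓ b 1 (b + 1 + 1 + 1) = 0 := by
            unfold N₃; split_ifs <;> omega
          have h5 : b + 1 + 1 ≠ b := by omega
          simp [cas, h2, h3, h4, h5]
          right
          ring
        · have h4 : N₃ ℓ b 1 (k + 1 + 1) = 0 := by
            unfold N₃; split_ifs <;> omega
          have h5 : k + 1 ≠ b := hne.symm
          have h6 : k + 1 = ℓ → b ≠ ℓ := by omega
          have h7 : k ≠ b + 1 := hne2
          have h8 : b ≠ k + 1 + 2 := by omega
          simpa [h4, h5, hne, h7, h8] using h6

theorem rL_one (ℓ t : ℕ) (hℓ : 1 ≤ ℓ) : rL ℓ 1 (t : ℤ) = if t = 1 then 1 else 0 := by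
  simp only [rL]
  split_ifs <;> omega

/-- An intersection number with two legs of size one is a product of path counts. -/
theorem IF_one_one (ℓ j k : ℕ) (hℓ : 1 ≤ ℓ) :
    IF ℓ j k 1 1 = (rL ℓ j ℓ : ℚ) * (rL ℓ k ℓ : ℚ) := by
  have h : ∀ a ∈ Finset.range (ℓ + 1), ∀ b ∈ Finset.range (ℓ + 1),
      ∑ μ₃ ∈ Finset.range (ℓ + 1), ∑ μ₄ ∈ Finset.range (ℓ + 1),
        degF ℓ a b μ₃ μ₄ * (rL ℓ j (a : ℤ) : ℚ) * (rL ℓ k (b : ℤ) : ℚ)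
          * (rL ℓ 1 (μ₃ : ℤ) : ℚ) * (rL ℓ 1 (μ₄ : ℤ) : ℚ) =
      if a = ℓ then (if b = ℓ then (rL ℓ j (a : ℤ) : ℚ) * (rL ℓ k (b : ℤ) : ℚ) else 0) else 0 := by
    intro a ha b hb
    have h1 : 1 ∈ Finset.range (ℓ + 1) := by simp; omega
    simp_rw [rL_one ℓ _ hℓ]
    push_cast
    simp only [mul_ite, mul_one, mul_zero, Finset.sum_ite_eq', if_pos h1]
    rw [degF_one_one ℓ a b hℓ (by simpa [Nat.lt_succ_iff] using ha)
      (by simpa [Nat.lt_succ_iff] using hb)]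
    simp
  unfold IF
  rw [Finset.sum_congr rfl fun a ha => Finset.sum_congr rfl (h a ha)]
  simp

theorem rL_eq_zero_of_lt (ℓ j : ℕ) (t : ℤ) (h : (j : ℤ) < t) : rL ℓ j t = 0 := by
  induction j generalizing t with
  | zero => simp [rL]; omega
  | succ j ih =>
    simp only [rL]
    split_ifs
    · rfl
    · rw [ih _ (by push_cast at h; omega), ih _ (by push_cast at h; omega)]

theorem rL_eq_zero_of_neg (ℓ j : ℕ) (t : ℤ) (h : t < 0) : rL ℓ j t = 0 := by
  cases j with
  | zero => simp [rL]; omega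
  | succ j => simp [rL, h]

theorem rL_eq_zero_of_level_lt (ℓ j : ℕ) (t : ℤ) (h : (ℓ : ℤ) < t) : rL ℓ j t = 0 := by
  cases j with
  | zero => simp [rL]; omega
  | succ j => simp [rL, h]

theorem rL_self (ℓ j : ℕ) (h : j ≤ ℓ) : rL ℓ j (j : ℤ) = 1 := by
  induction j with
  | zero => simp [rL]
  | succ j ih =>
    simp only [rL]
    rw [if_neg (by push_cast; omega), rL_eq_zero_of_lt ℓ j (((j + 1 : ℕ) : ℤ) + 1) (by push_cast; omega)]
    simpa using ih (by omega)

theorem rL_succ_self (ℓ j : ℕ) : rL ℓ (j + 1) (j : ℤ) = 0 := by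
  induction j with
  | zero => simp [rL]
  | succ j ih =>
    rw [rL]
    split_ifs
    · rfl
    · rw [rL_eq_zero_of_lt ℓ (j + 1) (((j + 1 : ℕ) : ℤ) + 1) (by push_cast; omega)]
      simpa using ih

theorem rL_add_two_self (ℓ j : ℕ) (h : j < ℓ) : rL ℓ (j + 2) (j : ℤ) = j + 1 := by
  induction j with
  | zero =>
    have := rL_self ℓ 1 h
    rw [rL, if_neg (by omega), rL_eq_zero_of_neg ℓ _ _ (by omega)]
    simpa using this
  | succ j ih =>
    have h1 := rL_self ℓ (j + 2) h
    have h2 := ih (by omega)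
    rw [rL, if_neg (by push_cast; omega)]
    have e1 : ((j + 1 : ℕ) : ℤ) - 1 = j := by push_cast; ring
    have e2 : ((j + 1 : ℕ) : ℤ) + 1 = (j + 2 : ℕ) := by push_cast; ring
    rw [e1, e2, show j + 1 + 1 = j + 2 from rfl, h1, h2]

theorem rL_add_two_level (ℓ : ℕ) : rL ℓ (ℓ + 2) (ℓ : ℤ) = ℓ := by
  rw [rL, if_neg (by omega), rL_eq_zero_of_level_lt ℓ _ ((ℓ : ℤ) + 1) (by omega)]
  cases ℓ with
  | zero => simpa using rL_eq_zero_of_neg 0 1 (-1) (by norm_num)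
  | succ k =>
    have := rL_add_two_self (k + 1) k (by omega)
    simpa using this

/-- Level g−1 intersection numbers, with n = 2g+2. -/
theorem level_g_sub_one_intersection (g i : ℕ) (hg : 2 ≤ g) (hi1 : 1 ≤ i) (hi2 : i ≤ g) :
    (i = g - 1 → IF (g - 1) (2 * g + 2 - i - 2) i 1 1 = (g : ℚ) - 1) ∧
    (i ≠ g - 1 → IF (g - 1) (2 * g + 2 - i - 2) i 1 1 = 0) := by
  obtain ⟨ℓ, rfl⟩ : ∃ ℓ, g = ℓ + 1 := ⟨g - 1, by omega⟩
  rw [Nat.add_sub_cancel, IF_one_one ℓ _ _ (by omega)]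
  constructor
  · rintro rfl
    rw [show 2 * (i + 1) + 2 - i - 2 = i + 2 by omega, rL_add_two_level, rL_self i i le_rfl]
    push_cast
    ring
  · intro hne
    have hz : rL ℓ i (ℓ : ℤ) = 0 := by
      rcases lt_or_gt_of_ne hne with h | h
      · exact rL_eq_zero_of_lt ℓ i _ (by exact_mod_cast h)
      · obtain rfl : i = ℓ + 1 := by omega
        exact rL_succ_self ℓ ℓ
    simp [hz]
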